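/- Let t ≥ ℓ − 1 be an integer and let L = c_0x_0 + c_1x_1 + ⋯ + c_nx_n be a linear form (c_i ∈ k) such that c_0 + c_1P_{k,1} + ⋯ + c_nP_{k,n} ≠ 0 for every 1 ≤ k ≤ ℓ (i.e., L vanishes at no point of π_1(X)). Then (y_0, L + y_1) is a regular sequence on the S-module S/(I_X ∩ ⟨x⟩^t): y_0 is a nonzerodivisor on S/(I_X ∩ ⟨x⟩^t), and L + y_1 is a nonzerodivisor on S/((I_X ∩ ⟨x⟩^t) + ⟨y_0⟩). -/

import Mathlib

open MvPolynomial

noncomputable section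

/-- The Cox ring `S = k[x_0,…,x_n, y_0,…,y_m]` of `ℙⁿ × ℙᵐ`. -/
abbrev Cox (k : Type*) [Field k] (n m : ℕ) : Type _ :=
  MvPolynomial (Fin (n + 1) ⊕ Fin (m + 1)) k

variable {k : Type*} [Field k] {n m : ℕ}

/-- The vanishing ideal `⟨a_i x_0 - x_i : 1 ≤ i ≤ n⟩` of the point
`[1 : a_1 : ⋯ : a_n] ∈ ℙⁿ`. -/
def Ia (n m : ℕ) (a : Fin n → k) : Ideal (Cox k n m) :=
  Ideal.span (Set.range fun i : Fin n =>
    C (a i) * X (Sum.inl 0) - X (Sum.inl i.succ))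

/-- The vanishing ideal `⟨b_j y_0 - y_j : 1 ≤ j ≤ m⟩` of the point
`[1 : b_1 : ⋯ : b_m] ∈ ℙᵐ`. -/
def Ib (n m : ℕ) (b : Fin m → k) : Ideal (Cox k n m) :=
  Ideal.span (Set.range fun j : Fin m =>
    C (b j) * X (Sum.inr 0) - X (Sum.inr j.succ))

/-- The ideal `⟨x_0, …, x_n⟩`. -/
def xIdeal (k : Type*) [Field k] (n m : ℕ) : Ideal (Cox k n m) :=
  Ideal.span (Set.range fun i : Fin (n + 1) => (X (Sum.inl i) : Cox k n m))

/-- The ideal `I_{X_a} = I_{P_a} + ⋂_j I_{Q_{a,j}}` of the fiber `X_a` of `X` over the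
point `P_a ∈ ℙⁿ`. -/
def IXk {ℓ : ℕ} (n m : ℕ) (P : Fin ℓ → Fin n → k) (r : Fin ℓ → ℕ)
    (Q : (a : Fin ℓ) → Fin (r a) → Fin m → k) (a : Fin ℓ) : Ideal (Cox k n m) :=
  Ia n m (P a) + ⨅ j : Fin (r a), Ib n m (Q a j)


/-! helpers -/

abbrev AA (k : Type*) [Field k] (m : ℕ) := MvPolynomial (Fin (m + 1)) k

def phi (n m : ℕ) (a : Fin n → k) : Cox k n m →ₐ[k] Polynomial (AA k m) :=
  aeval (Sum.elim (Fin.cons Polynomial.X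
    (fun i => Polynomial.C (C (a i)) * Polynomial.X)) (fun j => Polynomial.C (X j)))

def sig (n m : ℕ) : Polynomial (AA k m) →+* Cox k n m :=
  Polynomial.eval₂RingHom (rename Sum.inr : AA k m →ₐ[k] Cox k n m).toRingHom (X (Sum.inl 0))

def ev (m : ℕ) (b : Fin m → k) : AA k m →ₐ[k] Polynomial k :=
  aeval (Fin.cons Polynomial.X (fun i => Polynomial.C (b i) * Polynomial.X))

@[simp] lemma phi_x0 (a : Fin n → k) : phi n m a (X (Sum.inl 0)) = Polynomial.X := by
  simp [phi]
@[simp] lemma phi_xs (a : Fin n → k) (i : Fin n) :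
    phi n m a (X (Sum.inl i.succ)) = Polynomial.C (C (a i)) * Polynomial.X := by
  simp [phi]
@[simp] lemma phi_y (a : Fin n → k) (j : Fin (m+1)) :
    phi n m a (X (Sum.inr j)) = Polynomial.C (X j) := by
  simp [phi]
@[simp] lemma phi_C (a : Fin n → k) (c : k) :
    phi n m a (C c) = Polynomial.C (C c) := by
  simp only [phi, algHom_C]; rfl
@[simp] lemma sig_X : sig (k := k) n m Polynomial.X = X (Sum.inl 0) := by simp [sig]
@[simp] lemma sig_C (f : AA k m) : sig (k := k) n m (Polynomial.C f) = rename Sum.inr f := by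
  simp [sig]
@[simp] lemma ev_0 (b : Fin m → k) : ev m b (X 0) = Polynomial.X := by simp [ev]
@[simp] lemma ev_s (b : Fin m → k) (i : Fin m) :
    ev m b (X i.succ) = Polynomial.C (b i) * Polynomial.X := by simp [ev]

lemma phi_sig (a : Fin n → k) (q : Polynomial (AA k m)) : phi n m a (sig n m q) = q := by
  have : (phi n m a).toRingHom.comp (sig n m) = RingHom.id _ := by
    apply Polynomial.ringHom_ext
    · intro f
      have h : ((phi n m a).comp (rename Sum.inr : AA k m →ₐ[k] Cox k n m)) =
        (Algebra.ofId (AA k m) (Polynomial (AA k m))).restrictScalars k := by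
        apply MvPolynomial.algHom_ext
        intro i
        simp [Algebra.ofId_apply]
      simpa using DFunLike.congr_fun h f
    · simp
  exact DFunLike.congr_fun this q

lemma sub_sig_phi (a : Fin n → k) (p : Cox k n m) : p - sig n m (phi n m a p) ∈ Ia n m a := by
  rw [← Ideal.Quotient.mk_eq_mk_iff_sub_mem]
  have : (Ideal.Quotient.mk (Ia n m a)) =
    (Ideal.Quotient.mk (Ia n m a)).comp ((sig n m).comp (phi n m a).toRingHom) := by
    apply MvPolynomial.ringHom_ext
    · intro r; simp
    · rintro (i | j)
      · refine Fin.cases ?_ (fun i => ?_) i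
        · simp
        · symm
          simp only [RingHom.comp_apply]
          rw [Ideal.Quotient.mk_eq_mk_iff_sub_mem]
          refine Ideal.subset_span ⟨i, ?_⟩
          simp
      · simp
  exact DFunLike.congr_fun this p

def Ja (m : ℕ) {r : ℕ} (Q : Fin r → Fin m → k) : Ideal (AA k m) :=
  ⨅ j, RingHom.ker (ev m (Q j)).toRingHom

lemma mem_Ja {r : ℕ} (Q : Fin r → Fin m → k) (f : AA k m) :
    f ∈ Ja m Q ↔ ∀ j, ev m (Q j) f = 0 := by
  simp [Ja, Ideal.mem_iInf, RingHom.mem_ker]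

lemma rename_mem_Ib (b : Fin m → k) (f : AA k m) (hf : ev m b f = 0) :
    (rename Sum.inr f : Cox k n m) ∈ Ib n m b := by
  rw [← Ideal.Quotient.eq_zero_iff_mem]
  have : (Ideal.Quotient.mkₐ k (Ib n m b)).comp (rename Sum.inr : AA k m →ₐ[k] Cox k n m) =
    ((Ideal.Quotient.mkₐ k (Ib n m b)).comp (Polynomial.aeval (X (Sum.inr 0)))).comp (ev m b) := by
    apply MvPolynomial.algHom_ext
    intro i
    refine Fin.cases ?_ (fun i => ?_) i
    · simp
    · symm
      simp only [AlgHom.comp_apply, Ideal.Quotient.mkₐ_eq_mk]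
      rw [Ideal.Quotient.mk_eq_mk_iff_sub_mem]
      refine Ideal.subset_span ⟨i, ?_⟩
      simp [MvPolynomial.algebraMap_eq]
  have h := DFunLike.congr_fun this f
  simpa [hf] using h

lemma Ib_le (a : Fin n → k) (b : Fin m → k) :
    Ib n m b ≤ RingHom.ker ((Polynomial.mapRingHom (ev m b).toRingHom).comp
      (phi n m a).toRingHom) := by
  rw [Ib, Ideal.span_le]
  rintro _ ⟨j, rfl⟩
  have : (ev m b) (C (b j)) = Polynomial.C (b j) := by
    simp only [algHom_C]; rfl
  simp [RingHom.mem_ker, this]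

lemma mem_IXk {ℓ : ℕ} (P : Fin ℓ → Fin n → k) (r : Fin ℓ → ℕ)
    (Q : (a : Fin ℓ) → Fin (r a) → Fin m → k) (a : Fin ℓ) (p : Cox k n m) :
    p ∈ IXk n m P r Q a ↔ ∀ d, (phi n m (P a) p).coeff d ∈ Ja m (Q a) := by
  rw [← Ideal.mem_map_C_iff]
  constructor
  · intro h
    have : IXk n m P r Q a ≤ ((Ja m (Q a)).map Polynomial.C).comap (phi n m (P a)) := by
      rw [IXk, Submodule.add_eq_sup]
      apply sup_le
      · rw [Ia, Ideal.span_le]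
        rintro _ ⟨j, rfl⟩
        simp
      · intro p hp
        rw [Ideal.mem_comap, Ideal.mem_map_C_iff]
        intro d
        rw [mem_Ja]
        intro j
        rw [Ideal.mem_iInf] at hp
        have := Ib_le (P a) (Q a j) (hp j)
        rw [RingHom.mem_ker] at this
        have := congrArg (fun q => Polynomial.coeff q d) this
        simpa using this
    exact this h
  · intro h
    rw [Ideal.mem_map_C_iff] at h
    have e : p = (p - sig n m (phi n m (P a) p)) + sig n m (phi n m (P a) p) := by ring
    rw [e, IXk, Submodule.add_eq_sup]
    refine Submodule.add_mem_sup (sub_sig_phi _ _) ?_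
    rw [Ideal.mem_iInf]
    intro j
    rw [sig, Polynomial.coe_eval₂RingHom, Polynomial.eval₂_eq_sum_range]
    refine Ideal.sum_mem _ fun d _ => Ideal.mul_mem_right _ _ ?_
    exact rename_mem_Ib _ _ ((mem_Ja _ _).1 (h d) j)

/-! grading -/

def th (k : Type*) [Field k] (n m : ℕ) : Cox k n m →ₐ[k] Polynomial (Cox k n m) :=
  aeval (Sum.elim (fun i => Polynomial.C (X (Sum.inl i)) * Polynomial.X)
    (fun j => Polynomial.C (X (Sum.inr j))))

lemma th_coeff_mem (p : Cox k n m) : ∀ d, (th k n m p).coeff d ∈ xIdeal k n m ^ d := by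
  induction p using MvPolynomial.induction_on with
  | C a =>
    intro d
    have : th k n m (C a) = Polynomial.C (C a) := by simp only [th, algHom_C]; rfl
    rw [this, Polynomial.coeff_C]
    split_ifs with h
    · subst h; simp
    · simp
  | add p q hp hq => intro d; simpa using Ideal.add_mem _ (hp d) (hq d)
  | mul_X p i hp =>
    intro d
    rcases i with i | i
    · have : th k n m (p * X (Sum.inl i)) =
        (th k n m p * Polynomial.C (X (Sum.inl i))) * Polynomial.X := by
        simp [th, mul_assoc]
      rw [this]
      cases d with
      | zero => simp
      | succ d =>
        rw [Polynomial.coeff_mul_X, Polynomial.coeff_mul_C, pow_succ]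
        exact Ideal.mul_mem_mul (hp d) (Ideal.subset_span ⟨i, rfl⟩)
    · have : th k n m (p * X (Sum.inr i)) = (th k n m p * Polynomial.C (X (Sum.inr i))) := by
        simp [th]
      rw [this, Polynomial.coeff_mul_C]
      exact Ideal.mul_mem_right _ _ (hp d)

lemma th_eval (p : Cox k n m) : (th k n m p).eval 1 = p := by
  have : (Polynomial.evalRingHom (1 : Cox k n m)).comp (th k n m).toRingHom = RingHom.id _ := by
    apply MvPolynomial.ringHom_ext
    · intro r
      have : th k n m (C r) = Polynomial.C (C r) := by simp only [th, algHom_C]; rfl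
      simp [this]
    · rintro (i | j) <;> simp [th]
  exact DFunLike.congr_fun this p

lemma pow_le_dvd {R : Type*} [CommRing R] (f : Cox k n m →+* R) (w : R)
    (h : ∀ i, w ∣ f (X (Sum.inl i))) (t : ℕ) (p : Cox k n m) (hp : p ∈ xIdeal k n m ^ t) :
    w ^ t ∣ f p := by
  have h1 : xIdeal k n m ≤ (Ideal.span {w}).comap f := by
    rw [xIdeal, Ideal.span_le]
    rintro _ ⟨i, rfl⟩
    simpa [Ideal.mem_span_singleton] using h i
  have h2 := (Ideal.pow_right_mono h1 t).trans (Ideal.le_comap_pow f t) hp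
  rwa [Ideal.mem_comap, Ideal.span_singleton_pow, Ideal.mem_span_singleton] at h2

lemma th_coeff_zero (t : ℕ) (p : Cox k n m) (hp : p ∈ xIdeal k n m ^ t) (d : ℕ) (hd : d < t) :
    (th k n m p).coeff d = 0 := by
  have := pow_le_dvd (th k n m).toRingHom Polynomial.X (fun i => by simp [th]) t p hp
  exact (Polynomial.X_pow_dvd_iff.1 this) d hd

lemma mem_of_coeff (t : ℕ) (p : Cox k n m) (I : Ideal (Cox k n m))
    (h : ∀ d < t, (th k n m p).coeff d ∈ I) : p ∈ I ⊔ xIdeal k n m ^ t := by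
  rw [← th_eval p, Polynomial.eval_eq_sum_range]
  refine Ideal.sum_mem _ fun d _ => Ideal.mul_mem_right _ _ ?_
  by_cases hd : d < t
  · exact Ideal.mem_sup_left (h d hd)
  · exact Ideal.mem_sup_right (Ideal.pow_le_pow_right (not_lt.1 hd) (th_coeff_mem p d))

lemma y0_xIdeal (t : ℕ) (p : Cox k n m) (h : X (Sum.inr 0) * p ∈ xIdeal k n m ^ t) :
    p ∈ xIdeal k n m ^ t := by
  have := mem_of_coeff t p ⊥ fun d hd => by
    have := th_coeff_zero t _ h d hd
    have e : th k n m (X (Sum.inr 0) * p) = Polynomial.C (X (Sum.inr 0)) * th k n m p := by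
      simp [th]
    rw [e, Polynomial.coeff_C_mul] at this
    simpa using this
  simpa using this

lemma y0_IXk {ℓ : ℕ} (P : Fin ℓ → Fin n → k) (r : Fin ℓ → ℕ)
    (Q : (a : Fin ℓ) → Fin (r a) → Fin m → k) (a : Fin ℓ) (p : Cox k n m)
    (h : X (Sum.inr 0) * p ∈ IXk n m P r Q a) : p ∈ IXk n m P r Q a := by
  rw [mem_IXk] at h ⊢
  intro d
  rw [mem_Ja]
  intro j
  have := (mem_Ja _ _).1 (h d) j
  simpa using this

lemma xt_nzd (hm : 1 ≤ m) (t : ℕ) (c : Fin (n + 1) → k) (L : Cox k n m)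
    (hL : L = ∑ i : Fin (n + 1), C (c i) * X (Sum.inl i)) (p : Cox k n m)
    (h : (L + X (Sum.inr 1)) * p ∈ Ideal.span {(X (Sum.inr 0) : Cox k n m)} ⊔ xIdeal k n m ^ t) :
    p ∈ Ideal.span {(X (Sum.inr 0) : Cox k n m)} ⊔ xIdeal k n m ^ t := by
  apply mem_of_coeff
  obtain ⟨u, hu, v, hv, e⟩ := Submodule.mem_sup.1 h
  obtain ⟨w, rfl⟩ := Ideal.mem_span_singleton.1 hu
  have hc : ∀ d < t, (X (Sum.inr 0) : Cox k n m) ∣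
      (th k n m ((L + X (Sum.inr 1)) * p)).coeff d := by
    intro d hd
    rw [← e, map_add, Polynomial.coeff_add, th_coeff_zero t v hv d hd]
    have e : th k n m (X (Sum.inr 0) * w) = Polynomial.C (X (Sum.inr 0)) * th k n m w := by
      simp [th]
    rw [e, Polynomial.coeff_C_mul]
    simp
  have hCC : ∀ a, th k n m (C a) = Polynomial.C (C a) := fun a => by
    simp only [th, algHom_C]; rfl
  have e2 : th k n m ((L + X (Sum.inr 1)) * p) = (Polynomial.C L * th k n m p) * Polynomial.X
      + Polynomial.C (X (Sum.inr 1)) * th k n m p := by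
    have : th k n m L = Polynomial.C L * Polynomial.X := by
      rw [hL]
      simp only [map_sum, map_mul, hCC, Finset.sum_mul]
      simp [th, mul_assoc]
    have h2 : th k n m (X (Sum.inr 1)) = Polynomial.C (X (Sum.inr 1)) := by simp [th]
    rw [map_mul, map_add, this, h2]; ring
  have hpr : Prime (X (Sum.inr 0) : Cox k n m) := MvPolynomial.X_prime
  have hnd : ¬ (X (Sum.inr 0) : Cox k n m) ∣ X (Sum.inr 1) := by
    rw [MvPolynomial.X_dvd_X]
    rintro h
    have : (0 : Fin (m+1)) = 1 := by simpa using h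
    obtain ⟨m, rfl⟩ : ∃ m', m = m' + 1 := ⟨m - 1, by omega⟩
    exact Fin.zero_ne_one this
  intro d
  induction d with
  | zero =>
    intro hd
    have := hc 0 hd
    rw [e2] at this
    simp only [Polynomial.coeff_add, Polynomial.mul_coeff_zero, Polynomial.coeff_X_zero, mul_zero,
      zero_add, Polynomial.coeff_C_zero] at this
    rw [Ideal.mem_span_singleton]
    exact (hpr.dvd_or_dvd this).resolve_left hnd
  | succ d ih =>
    intro hd
    have := hc (d+1) hd
    have ih := Ideal.mem_span_singleton.1 (ih (by omega))
    rw [e2] at this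
    simp only [Polynomial.coeff_add, Polynomial.coeff_mul_X, Polynomial.coeff_C_mul] at this
    rw [Ideal.mem_span_singleton]
    rw [dvd_add_right (ih.mul_left _)] at this
    exact (hpr.dvd_or_dvd this).resolve_left hnd

lemma poly_nzd {A : Type*} [CommRing A] (K : Ideal A) (l y : A) (hl : IsUnit l)
    (q : Polynomial A)
    (h : ∀ d, ((Polynomial.C l * Polynomial.X + Polynomial.C y) * q).coeff d ∈ K) (d : ℕ) :
    q.coeff d ∈ K := by
  have key : ∀ N d, q.natDegree < d + N → q.coeff d ∈ K := by
    intro N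
    induction N with
    | zero => intro d hd; rw [Polynomial.coeff_eq_zero_of_natDegree_lt (by omega)]; simp
    | succ N ih =>
      intro d hd
      have h1 := h (d + 1)
      have e : (Polynomial.C l * Polynomial.X + Polynomial.C y) * q =
        (Polynomial.C l * q) * Polynomial.X + Polynomial.C y * q := by ring
      rw [e, Polynomial.coeff_add, Polynomial.coeff_mul_X, Polynomial.coeff_C_mul,
        Polynomial.coeff_C_mul, Ideal.add_mem_iff_left _ (K.mul_mem_left _ (ih (d+1) (by omega)))] at h1
      exact (Ideal.unit_mul_mem_iff_mem K hl).1 h1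
  exact key (q.natDegree + 1) d (by omega)

lemma sep {ℓ : ℕ} (P : Fin ℓ → Fin n → k) (hP : Function.Injective P) (t : ℕ) (ht : ℓ - 1 ≤ t)
    (a : Fin ℓ) : ∃ E ∈ xIdeal k n m ^ t, phi n m (P a) E = Polynomial.X ^ t ∧
      ∀ b, b ≠ a → phi n m (P b) E = 0 := by
  have h1 : ∀ b, b ≠ a → ∃ l ∈ xIdeal k n m, phi n m (P a) l = Polynomial.X ∧
      phi n m (P b) l = 0 := by
    intro b hb
    obtain ⟨i, hi⟩ := Function.ne_iff.1 (hP.ne hb)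
    refine ⟨C ((P a i - P b i)⁻¹) * (X (Sum.inl i.succ) - C (P b i) * X (Sum.inl 0)), ?_, ?_, ?_⟩
    · refine Ideal.mul_mem_left _ _ (Ideal.sub_mem _ (Ideal.subset_span ⟨_, rfl⟩)
        (Ideal.mul_mem_left _ _ (Ideal.subset_span ⟨_, rfl⟩)))
    · simp only [map_mul, map_sub, phi_C, phi_xs, phi_x0]
      rw [← sub_mul, ← mul_assoc, ← map_sub, ← map_sub, ← map_mul, ← map_mul,
        inv_mul_cancel₀ (sub_ne_zero.2 (Ne.symm hi))]
      simp
    · simp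
  choose! l hl1 hl2 hl3 using h1
  have hcard : (Finset.univ.erase a).card = ℓ - 1 := by simp
  have hpow : (ℓ - 1) + (t - (ℓ - 1)) = t := by omega
  refine ⟨(∏ b ∈ Finset.univ.erase a, l b) * X (Sum.inl 0) ^ (t - (ℓ - 1)), ?_, ?_, ?_⟩
  · have e : xIdeal k n m ^ t = xIdeal k n m ^ (ℓ - 1) * xIdeal k n m ^ (t - (ℓ - 1)) := by
      rw [← pow_add, hpow]
    rw [e]
    have hx : (X (Sum.inl 0) : Cox k n m) ∈ xIdeal k n m := Ideal.subset_span ⟨0, rfl⟩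
    refine Ideal.mul_mem_mul ?_ (Ideal.pow_mem_pow hx _)
    rw [← hcard, ← Finset.prod_const]
    exact Ideal.prod_mem_prod fun b hb => hl1 b (Finset.ne_of_mem_erase hb)
  · rw [map_mul, map_prod, Finset.prod_congr rfl (fun b hb => hl2 b (Finset.ne_of_mem_erase hb)),
      Finset.prod_const, hcard, map_pow, phi_x0, ← pow_add, hpow]
  · intro b hb
    rw [map_mul, map_prod, Finset.prod_eq_zero (i := b) (by simp [hb]) (hl3 b hb), zero_mul]

lemma combine {ℓ : ℕ} (P : Fin ℓ → Fin n → k) (hP : Function.Injective P) (r : Fin ℓ → ℕ)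
    (Q : (a : Fin ℓ) → Fin (r a) → Fin m → k) (t : ℕ) (ht : ℓ - 1 ≤ t) (p : Cox k n m)
    (h1 : p ∈ Ideal.span {(X (Sum.inr 0) : Cox k n m)} ⊔ xIdeal k n m ^ t)
    (h2 : ∀ a d, (phi n m (P a) p).coeff d ∈ Ja m (Q a) ⊔ Ideal.span {(X 0 : AA k m)}) :
    p ∈ ((⨅ a : Fin ℓ, IXk n m P r Q a) ⊓ xIdeal k n m ^ t) +
              Ideal.span {(X (Sum.inr 0) : Cox k n m)} := by
  obtain ⟨u, hu, g, hg, rfl⟩ := Submodule.mem_sup.1 h1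
  rw [Submodule.add_eq_sup]
  refine Ideal.add_mem _ (Ideal.mem_sup_right hu) ?_
  obtain ⟨w, rfl⟩ := Ideal.mem_span_singleton.1 hu
  have hga : ∀ a, ∃ q h : Polynomial (AA k m), phi n m (P a) g =
      Polynomial.X ^ t * (q + Polynomial.C (X 0) * h) ∧ q ∈ (Ja m (Q a)).map Polynomial.C := by
    intro a
    obtain ⟨s, hs⟩ := pow_le_dvd (phi n m (P a)).toRingHom Polynomial.X (fun i => by
      refine Fin.cases ?_ (fun i => ?_) i <;> simp) t g hg
    have hs : phi n m (P a) g = Polynomial.X ^ t * s := hs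
    have : s ∈ (Ja m (Q a) ⊔ Ideal.span {(X 0 : AA k m)}).map Polynomial.C := by
      rw [Ideal.mem_map_C_iff]
      intro d
      have := h2 a (d + t)
      rw [map_add, map_mul, phi_y, hs, Polynomial.coeff_add, Polynomial.coeff_C_mul,
        Polynomial.coeff_X_pow_mul] at this
      rwa [Ideal.add_mem_iff_right] at this
      exact Ideal.mul_mem_right _ _ (Ideal.mem_sup_right (Ideal.mem_span_singleton_self _))
    rw [Ideal.map_sup, Ideal.map_span, Set.image_singleton] at this
    obtain ⟨q, hq, v, hv, rfl⟩ := Submodule.mem_sup.1 this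
    obtain ⟨h, rfl⟩ := Ideal.mem_span_singleton.1 hv
    exact ⟨q, h, hs, hq⟩
  choose q h hgq hq using hga
  choose E hE hEa hEb using fun a => sep (m := m) P hP t ht a
  let H : Cox k n m := ∑ a, E a * sig n m (h a)
  have hH : H ∈ xIdeal k n m ^ t := Ideal.sum_mem _ fun a _ => Ideal.mul_mem_right _ _ (hE a)
  have hHb : ∀ b, phi n m (P b) H = Polynomial.X ^ t * h b := by
    intro b
    simp only [H, map_sum, map_mul, phi_sig]
    rw [Finset.sum_eq_single b, hEa]
    · intro a _ hab; rw [hEb a b hab.symm, zero_mul]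
    · simp
  have e : g = (g - X (Sum.inr 0) * H) + X (Sum.inr 0) * H := by ring
  rw [e]
  refine Submodule.add_mem_sup ⟨?_, Ideal.sub_mem _ hg (Ideal.mul_mem_left _ _ hH)⟩
    (Ideal.mul_mem_right _ _ (Ideal.mem_span_singleton_self _))
  refine (Ideal.mem_iInf).2 fun b => ?_
  rw [mem_IXk, ← Ideal.mem_map_C_iff, map_sub, map_mul, hHb, hgq, phi_y]
  have : Polynomial.X ^ t * (q b + Polynomial.C (X 0) * h b) -
    Polynomial.C (X 0) * (Polynomial.X ^ t * h b) = Polynomial.X ^ t * q b := by ring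
  rw [this]
  exact Ideal.mul_mem_left _ _ (hq b)

/-- **Key step of Theorem 1.1**: if `t ≥ ℓ - 1` and `L = c_0 x_0 + ⋯ + c_n x_n` is a
linear form vanishing at no point of `π₁(X)`, then `(y_0, L + y_1)` is a regular
sequence on `S/(I_X ∩ ⟨x⟩^t)`: namely `y_0` is a nonzerodivisor on
`S/(I_X ∩ ⟨x⟩^t)`, and `L + y_1` is a nonzerodivisor on `S/((I_X ∩ ⟨x⟩^t) + ⟨y_0⟩)`. -/
theorem stmt8 (k : Type*) [Field k] [IsAlgClosed k] (n m : ℕ) (hn : 1 ≤ n) (hm : 1 ≤ m)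
    (ℓ : ℕ) (hℓ : 1 ≤ ℓ)
    (P : Fin ℓ → Fin n → k) (hP : Function.Injective P)
    (r : Fin ℓ → ℕ) (hr : ∀ a, 1 ≤ r a)
    (Q : (a : Fin ℓ) → Fin (r a) → Fin m → k)
    (hQ : ∀ a, Function.Injective (Q a))
    (t : ℕ) (ht : ℓ - 1 ≤ t)
    (c : Fin (n + 1) → k)
    (hc : ∀ a : Fin ℓ, c 0 + ∑ i : Fin n, c i.succ * P a i ≠ 0)
    (L : Cox k n m) (hLdef : L = ∑ i : Fin (n + 1), C (c i) * X (Sum.inl i)) :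
    (∀ p : Cox k n m,
        (X (Sum.inr 0) : Cox k n m) * p ∈ (⨅ a : Fin ℓ, IXk n m P r Q a) ⊓ xIdeal k n m ^ t →
        p ∈ (⨅ a : Fin ℓ, IXk n m P r Q a) ⊓ xIdeal k n m ^ t) ∧
      (∀ p : Cox k n m,
        (L + X (Sum.inr 1)) * p ∈
            ((⨅ a : Fin ℓ, IXk n m P r Q a) ⊓ xIdeal k n m ^ t) +
              Ideal.span {(X (Sum.inr 0) : Cox k n m)} →
        p ∈ ((⨅ a : Fin ℓ, IXk n m P r Q a) ⊓ xIdeal k n m ^ t) +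
              Ideal.span {(X (Sum.inr 0) : Cox k n m)}) := by
  refine ⟨fun p hp => ?_, fun p hp => ?_⟩
  · refine ⟨(Ideal.mem_iInf).2 fun a => ?_, y0_xIdeal t p hp.2⟩
    exact y0_IXk P r Q a p ((Ideal.mem_iInf).1 hp.1 a)
  · rw [Submodule.add_eq_sup] at hp
    apply combine P hP r Q t ht
    · apply xt_nzd hm t c L hLdef
      have hle : (⨅ a, IXk n m P r Q a) ⊓ xIdeal k n m ^ t ⊔ Ideal.span {X (Sum.inr 0)} ≤
          Ideal.span {X (Sum.inr 0)} ⊔ xIdeal k n m ^ t :=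
        sup_le (le_trans inf_le_right le_sup_right) le_sup_left
      exact hle hp
    · intro a
      apply poly_nzd _ (C (c 0 + ∑ i : Fin n, c i.succ * P a i)) (X 1)
        ((isUnit_iff_ne_zero.2 (hc a)).map C)
      intro d
      have e : Polynomial.C (C (c 0 + ∑ i : Fin n, c i.succ * P a i)) * Polynomial.X
          + Polynomial.C (X 1) = phi n m (P a) (L + X (Sum.inr 1)) := by
        rw [map_add (phi n m (P a)), phi_y, hLdef, Fin.sum_univ_succ]
        simp only [map_add, map_sum, map_mul, phi_C, phi_xs, phi_x0, add_mul, Finset.sum_mul,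
          mul_assoc]
      rw [e, ← map_mul]
      obtain ⟨u, hu, v, hv, e2⟩ := Submodule.mem_sup.1 hp
      obtain ⟨w, rfl⟩ := Ideal.mem_span_singleton.1 hv
      rw [← e2, map_add, map_mul, phi_y, Polynomial.coeff_add, Polynomial.coeff_C_mul]
      refine Submodule.add_mem_sup ((mem_IXk P r Q a u).1 ((Ideal.mem_iInf).1 hu.1 a) d)
        (Ideal.mul_mem_right _ _ (Ideal.mem_span_singleton_self _))
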